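/- arXiv:0806.1935 — 8 statements merged into one kernel-verified Lean document; each statement's English description precedes it below -/
import Mathlib

section
/- For every integer l ≥ 3 one has b(l) < a(2l); that is, the number of nilpotent adjoint orbits in a simple complex Lie algebra of type B_l is strictly smaller than the number of nilpotent adjoint orbits in type A_{2l}. -/
/-- The number of partitions of `n`: multisets of positive integers with sum `n`. -/
noncomputable def numPartitions (n : ℕ) : ℕ :=
  Nat.card {l : Multiset ℕ // (∀ i ∈ l, 0 < i) ∧ l.sum = n}

/-- `a n` is the number of partitions of `n + 1`, i.e. the number of nilpotent
adjoint orbits in the simple complex Lie algebra of type `A_n`. -/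
noncomputable def a (n : ℕ) : ℕ := numPartitions (n + 1)

/-- `b m` is the number of pairs `(λ, μ)` of partitions with `2|λ| + |μ| = 2m + 1`
where the parts of `μ` are pairwise distinct and all odd; this is the number of
nilpotent adjoint orbits in type `B_m`. -/
noncomputable def b (m : ℕ) : ℕ :=
  Nat.card {p : Multiset ℕ × Multiset ℕ //
    (∀ i ∈ p.1, 0 < i) ∧ (∀ i ∈ p.2, 0 < i) ∧ p.2.Nodup ∧ (∀ i ∈ p.2, Odd i) ∧
    2 * p.1.sum + p.2.sum = 2 * m + 1}

/-- `c m` is the number of pairs `(λ, μ)` of partitions with `|λ| + |μ| = m`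
where the parts of `μ` are pairwise distinct; this is the number of
nilpotent adjoint orbits in type `C_m`. -/
noncomputable def c (m : ℕ) : ℕ :=
  Nat.card {p : Multiset ℕ × Multiset ℕ //
    (∀ i ∈ p.1, 0 < i) ∧ (∀ i ∈ p.2, 0 < i) ∧ p.2.Nodup ∧
    p.1.sum + p.2.sum = m}

/-- `d m` is the number of pairs `(λ, μ)` of partitions with `2|λ| + |μ| = 2m`
where the parts of `μ` are pairwise distinct and all odd; this is the number of
nilpotent adjoint orbits in type `D_m`. -/
noncomputable def d (m : ℕ) : ℕ :=
  Nat.card {p : Multiset ℕ × Multiset ℕ //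
    (∀ i ∈ p.1, 0 < i) ∧ (∀ i ∈ p.2, 0 < i) ∧ p.2.Nodup ∧ (∀ i ∈ p.2, Odd i) ∧
    2 * p.1.sum + p.2.sum = 2 * m}

instance finite_multiset_pos_sum (n : ℕ) :
    Finite {l : Multiset ℕ // (∀ i ∈ l, 0 < i) ∧ l.sum = n} :=
  Finite.of_injective
    (fun l => (⟨l.1, fun {i} hi => l.2.1 i hi, l.2.2⟩ : Nat.Partition n))
    fun _ _ h => Subtype.ext (congrArg Nat.Partition.parts h)

/-- A pair `(s, t)` with `t` duplicate-free is determined by `s + s + t`: the multiplicity of each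
element in `t` is the parity of its multiplicity in the sum. -/
theorem Multiset.add_self_add_inj_of_nodup {α : Type*} {s s' t t' : Multiset α}
    (ht : t.Nodup) (ht' : t'.Nodup) (h : s + s + t = s' + s' + t') : s = s' ∧ t = t' := by
  classical
  have key (x : α) : s.count x = s'.count x ∧ t.count x = t'.count x := by
    have hx := congrArg (Multiset.count x) h
    have h₁ := Multiset.nodup_iff_count_le_one.1 ht x
    have h₂ := Multiset.nodup_iff_count_le_one.1 ht' x
    simp only [Multiset.count_add] at hx
    omega
  exact ⟨Multiset.ext.2 fun x => (key x).1, Multiset.ext.2 fun x => (key x).2⟩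

theorem stmt_2 : ∀ l : ℕ, 3 ≤ l → b l < a (2 * l) := by
  intro l hl
  unfold a b numPartitions
  let f : {p : Multiset ℕ × Multiset ℕ //
      (∀ i ∈ p.1, 0 < i) ∧ (∀ i ∈ p.2, 0 < i) ∧ p.2.Nodup ∧ (∀ i ∈ p.2, Odd i) ∧
      2 * p.1.sum + p.2.sum = 2 * l + 1} →
      {s : Multiset ℕ // (∀ i ∈ s, 0 < i) ∧ s.sum = 2 * l + 1} := fun p =>
    ⟨p.1.1 + p.1.1 + p.1.2, by
      obtain ⟨⟨s, t⟩, hs, ht, -, -, hsum⟩ := p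
      refine ⟨fun i hi => ?_, ?_⟩
      · simp only [Multiset.mem_add, or_self] at hi
        exact hi.elim (hs i) (ht i)
      · simp only [Multiset.sum_add] at hsum ⊢
        omega⟩
  have hf : Function.Injective f := by
    rintro ⟨⟨s, t⟩, _, _, ht, _⟩ ⟨⟨s', t'⟩, _, _, ht', _⟩ h
    obtain ⟨rfl, rfl⟩ := Multiset.add_self_add_inj_of_nodup ht ht' (congrArg Subtype.val h)
    rfl
  have hf' : ¬ Function.Surjective f := by
    intro hsurj
    obtain ⟨⟨⟨s, t⟩, _, _, _, hodd, _⟩, h⟩ := hsurj ⟨{2, 2 * l - 1}, by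
      refine ⟨?_, ?_⟩
      · simp only [Multiset.insert_eq_cons, Multiset.mem_cons, Multiset.mem_singleton]
        omega
      · simp only [Multiset.insert_eq_cons, Multiset.sum_cons, Multiset.sum_singleton]
        omega⟩
    have hc := congrArg (Multiset.count 2) (congrArg Subtype.val h)
    have ht : t.count 2 = 0 := Multiset.count_eq_zero.2 fun h2 => by
      have := hodd 2 h2
      revert this
      decide
    have hne : 2 ≠ 2 * l - 1 := by omega
    simp only [f, Multiset.count_add, ht, Multiset.insert_eq_cons, Multiset.count_cons_self,
      Multiset.count_singleton, if_neg hne] at hc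
    omega
  have := Finite.of_injective f hf
  have := Fintype.ofFinite {s : Multiset ℕ // (∀ i ∈ s, 0 < i) ∧ s.sum = 2 * l + 1}
  have := Fintype.ofFinite {p : Multiset ℕ × Multiset ℕ //
      (∀ i ∈ p.1, 0 < i) ∧ (∀ i ∈ p.2, 0 < i) ∧ p.2.Nodup ∧ (∀ i ∈ p.2, Odd i) ∧
      2 * p.1.sum + p.2.sum = 2 * l + 1}
  rw [Nat.card_eq_fintype_card, Nat.card_eq_fintype_card]
  exact Fintype.card_lt_of_injective_not_surjective f hf hf'
end

section
/- For every integer l ≥ 3 one has c(l) < a(2l−1); that is, the number of nilpotent adjoint orbits in a simple complex Lie algebra of type C_l is strictly smaller than the number of nilpotent adjoint orbits in type A_{2l−1}. -/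
/-- Euler's theorem on partitions into odd and into distinct parts, packaged as a sum-preserving
injection on multisets. -/
theorem exists_odd_of_distinct : ∃ f : Multiset ℕ → Multiset ℕ,
    (∀ s, (∀ i ∈ s, 0 < i) → s.Nodup → (∀ i ∈ f s, Odd i) ∧ (f s).sum = s.sum) ∧
    (∀ s t, (∀ i ∈ s, 0 < i) → s.Nodup → (∀ i ∈ t, 0 < i) → t.Nodup → f s = f t → s = t) := by
  have e (n : ℕ) : Nonempty (Nat.Partition.distincts n ≃ Nat.Partition.odds n) :=
    ⟨Finset.equivOfCardEq (Nat.Partition.card_odds_eq_card_distincts n).symm⟩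
  classical
  let e' (n : ℕ) := (e n).some
  let P (s : Multiset ℕ) : Prop := (∀ i ∈ s, 0 < i) ∧ s.Nodup
  let dist (n : ℕ) (s : Multiset ℕ) (hs : P s) (h : s.sum = n) : Nat.Partition.distincts n :=
    ⟨⟨s, fun {i} hi => hs.1 i hi, h⟩, by simpa [Nat.Partition.distincts] using hs.2⟩
  let f (s : Multiset ℕ) : Multiset ℕ :=
    if hs : P s then (e' s.sum (dist s.sum s hs rfl)).1.parts else 0
  have hf (n : ℕ) (s : Multiset ℕ) (hs : P s) (h : s.sum = n) :
      f s = (e' n (dist n s hs h)).1.parts := by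
    subst h
    simp only [f, dif_pos hs]
  have hsum (s : Multiset ℕ) (hs : P s) : (f s).sum = s.sum := by
    rw [hf _ s hs rfl]
    exact Nat.Partition.parts_sum _
  refine ⟨f, fun s h0 h1 => ⟨fun i hi => ?_, hsum s ⟨h0, h1⟩⟩, fun s t hs hs' ht ht' hst => ?_⟩
  · rw [hf _ s ⟨h0, h1⟩ rfl] at hi
    have := (e' s.sum (dist s.sum s ⟨h0, h1⟩ rfl)).2
    simp only [Nat.Partition.odds, Nat.Partition.restricted, Finset.mem_filter] at this
    exact Nat.not_even_iff_odd.mp (this.2 i hi)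
  · have h : t.sum = s.sum := by rw [← hsum s ⟨hs, hs'⟩, ← hsum t ⟨ht, ht'⟩, hst]
    rw [hf _ s ⟨hs, hs'⟩ rfl, hf _ t ⟨ht, ht'⟩ h] at hst
    have := (e' s.sum).injective (Subtype.ext (Nat.Partition.ext hst))
    exact congrArg (fun p => p.1.parts) this

instance finite_partitions (n : ℕ) :
    Finite {l : Multiset ℕ // (∀ i ∈ l, 0 < i) ∧ l.sum = n} :=
  Finite.of_injective (β := Nat.Partition n)
    (fun l => ⟨l.1, fun {i} hi => l.2.1 i hi, l.2.2⟩)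
    fun _ _ h => Subtype.ext (congrArg Nat.Partition.parts h)

theorem filter_even_double_add {s t : Multiset ℕ} (ht : ∀ i ∈ t, Odd i) :
    (s.map (2 * ·) + 2 • t).filter Even = s.map (2 * ·) := by
  rw [Multiset.filter_add, Multiset.filter_eq_self.mpr, Multiset.filter_eq_nil.mpr, add_zero]
  · intro i hi
    exact Nat.not_even_iff_odd.mpr (ht i (Multiset.mem_of_mem_nsmul hi))
  · simp

theorem stmt_3 : ∀ l : ℕ, 3 ≤ l → c l < a (2 * l - 1) := by
  intro l hl
  obtain ⟨f, hf, hinj⟩ := exists_odd_of_distinct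
  unfold c a numPartitions
  rw [show 2 * l - 1 + 1 = 2 * l by omega]
  let F : {p : Multiset ℕ × Multiset ℕ // (∀ i ∈ p.1, 0 < i) ∧ (∀ i ∈ p.2, 0 < i) ∧
      p.2.Nodup ∧ p.1.sum + p.2.sum = l} →
      {s : Multiset ℕ // (∀ i ∈ s, 0 < i) ∧ s.sum = 2 * l} := fun p =>
    ⟨p.1.1.map (2 * ·) + 2 • f p.1.2, by
      obtain ⟨⟨s, t⟩, hs, ht, hd, h⟩ := p
      obtain ⟨hodd, hsum⟩ := hf t ht hd
      constructor
      · intro i hi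
        rcases Multiset.mem_add.mp hi with hi | hi
        · obtain ⟨j, hj, rfl⟩ := Multiset.mem_map.mp hi
          have := hs j hj
          omega
        · exact (hodd i (Multiset.mem_of_mem_nsmul hi)).pos
      · have hdouble : (s.map (2 * ·)).sum = 2 * s.sum := by
          simpa using Multiset.sum_map_mul_left (s := s) (a := 2) (f := id)
        simp only [Multiset.sum_add, Multiset.sum_nsmul, hdouble, hsum, smul_eq_mul]
        simp only at h
        omega⟩
  have hF : Function.Injective F := by
    rintro ⟨⟨s, t⟩, hs, ht, hd, h⟩ ⟨⟨s', t'⟩, hs', ht', hd', h'⟩ heq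
    have heq : s.map (2 * ·) + 2 • f t = s'.map (2 * ·) + 2 • f t' := congrArg Subtype.val heq
    have h1 := congrArg (Multiset.filter Even) heq
    rw [filter_even_double_add (hf t ht hd).1, filter_even_double_add (hf t' ht' hd').1] at h1
    rw [h1] at heq
    have h2 : f t = f t' := by
      have h3 := add_left_cancel heq
      ext i
      have := congrArg (Multiset.count i) h3
      simpa using this
    obtain rfl := hinj t t' ht hd ht' hd' h2
    obtain rfl := Multiset.map_injective (mul_right_injective₀ two_ne_zero) h1
    rfl
  let q : {s : Multiset ℕ // (∀ i ∈ s, 0 < i) ∧ s.sum = 2 * l} :=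
    ⟨{2 * l - 1, 1}, by simp; omega, by simp; omega⟩
  have hq : q ∉ Set.range F := by
    rintro ⟨p, hp⟩
    have h := congrArg (fun s => Multiset.count 1 s.1) hp
    have h0 : Multiset.count 1 (p.1.1.map (2 * ·)) = 0 :=
      Multiset.count_eq_zero.mpr (by simp)
    have h1 : Multiset.count 1 q.1 = 1 := by
      simp only [q, Multiset.insert_eq_cons, Multiset.count_cons, Multiset.count_singleton_self]
      split_ifs <;> omega
    simp only [F, Multiset.count_add, h0, Multiset.count_nsmul, h1] at h
    omega
  rw [← Nat.card_range_of_injective hF]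
  exact Set.ncard_lt_card fun h => hq (h ▸ Set.mem_univ q)
end

section
/- For every integer l ≥ 4 one has b(l−1) < d(l); that is, the number of nilpotent adjoint orbits in a simple complex Lie algebra of type B_{l−1} is strictly smaller than the number of nilpotent adjoint orbits in type D_l. -/
/-- Multisets of positive integers with bounded sum form a finite set. -/
theorem finite_multiset_pos_sum_le (N : ℕ) :
    {s : Multiset ℕ | (∀ i ∈ s, 0 < i) ∧ s.sum ≤ N}.Finite := by
  refine ((Set.finite_Iic N).biUnion fun n _ =>
    Set.finite_range (Nat.Partition.parts (n := n))).subset ?_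
  rintro s ⟨hs, hN⟩
  simp only [Set.mem_iUnion]
  exact ⟨s.sum, hN, ⟨s, fun {i} hi => hs i hi, rfl⟩, rfl⟩

/-- Raise `2|λ| + |μ|` by one: add the part `1` to `μ` if it is missing there, and otherwise
move it from `μ` to `λ`. -/
def raiseByOne (p : Multiset ℕ × Multiset ℕ) : Multiset ℕ × Multiset ℕ :=
  if 1 ∈ p.2 then (1 ::ₘ p.1, p.2.erase 1) else (p.1, 1 ::ₘ p.2)

theorem raiseByOne_injOn : Set.InjOn raiseByOne {p | p.2.Nodup} := by
  rintro ⟨s, t⟩ ht ⟨s', t'⟩ ht' h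
  simp only [Set.mem_ofPred_eq] at ht ht'
  by_cases h1 : 1 ∈ t <;> by_cases h1' : 1 ∈ t' <;>
    simp only [raiseByOne, h1, h1', if_true, if_false, Prod.mk.injEq] at h
  · have ht1 := congrArg (1 ::ₘ ·) h.2
    simp only [Multiset.cons_erase h1, Multiset.cons_erase h1'] at ht1
    rw [ht1, (Multiset.cons_inj_right 1).1 h.1]
  · exact absurd (h.2 ▸ Multiset.mem_cons_self 1 t') ht.notMem_erase
  · exact absurd (h.2 ▸ Multiset.mem_cons_self 1 t) ht'.notMem_erase
  · rw [h.1, (Multiset.cons_inj_right 1).1 h.2]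

/-- Pairs `(λ, μ)` of partitions with `2|λ| + |μ| = n` such that the parts of `μ` are distinct
and odd. -/
def orthogonalPairs (n : ℕ) : Set (Multiset ℕ × Multiset ℕ) :=
  {p | (∀ i ∈ p.1, 0 < i) ∧ (∀ i ∈ p.2, 0 < i) ∧ p.2.Nodup ∧ (∀ i ∈ p.2, Odd i) ∧
    2 * p.1.sum + p.2.sum = n}

theorem mem_orthogonalPairs {n : ℕ} {s t : Multiset ℕ} :
    (s, t) ∈ orthogonalPairs n ↔ (∀ i ∈ s, 0 < i) ∧ (∀ i ∈ t, 0 < i) ∧ t.Nodup ∧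
      (∀ i ∈ t, Odd i) ∧ 2 * s.sum + t.sum = n :=
  Iff.rfl

theorem finite_orthogonalPairs (n : ℕ) : (orthogonalPairs n).Finite := by
  refine ((finite_multiset_pos_sum_le n).prod (finite_multiset_pos_sum_le n)).subset ?_
  rintro p ⟨h₁, h₂, -, -, h⟩
  exact ⟨⟨h₁, by omega⟩, ⟨h₂, by omega⟩⟩

theorem raiseByOne_mem_orthogonalPairs {n : ℕ} {p : Multiset ℕ × Multiset ℕ}
    (hp : p ∈ orthogonalPairs n) : raiseByOne p ∈ orthogonalPairs (n + 1) := by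
  obtain ⟨s, t⟩ := p
  obtain ⟨hs, ht, hnd, hodd, hsum⟩ := mem_orthogonalPairs.1 hp
  by_cases h1 : 1 ∈ t
  · have hsum1 := Multiset.sum_erase h1
    simp only [raiseByOne, h1, if_true, mem_orthogonalPairs, Multiset.sum_cons]
    exact ⟨by simpa using hs, fun i hi => ht i (Multiset.mem_of_mem_erase hi),
      hnd.erase 1, fun i hi => hodd i (Multiset.mem_of_mem_erase hi), by omega⟩
  · simp only [raiseByOne, h1, if_false, mem_orthogonalPairs, Multiset.sum_cons]
    exact ⟨hs, by simpa using ht, Multiset.nodup_cons.2 ⟨h1, hnd⟩, by simpa using hodd, by omega⟩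

theorem raiseByOne_ne_singleton_zero {l : ℕ} (hl : l ≠ 1) (p : Multiset ℕ × Multiset ℕ) :
    raiseByOne p ≠ ({l}, 0) := by
  obtain ⟨s, t⟩ := p
  intro h
  by_cases h1 : 1 ∈ t <;> simp only [raiseByOne, h1, if_true, if_false, Prod.mk.injEq] at h
  · have : 1 ∈ ({l} : Multiset ℕ) := h.1 ▸ Multiset.mem_cons_self 1 s
    exact hl (Multiset.mem_singleton.1 this).symm
  · exact Multiset.cons_ne_zero h.2

theorem stmt_4 : ∀ l : ℕ, 4 ≤ l → b (l - 1) < d l := by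
  intro l hl
  change (orthogonalPairs (2 * (l - 1) + 1)).ncard < (orthogonalPairs (2 * l)).ncard
  have hl' : 2 * l = 2 * (l - 1) + 1 + 1 := by omega
  rw [← (raiseByOne_injOn.mono fun p hp => hp.2.2.1 :
    Set.InjOn raiseByOne (orthogonalPairs (2 * (l - 1) + 1))).ncard_image]
  refine Set.ncard_lt_ncard ((Set.ssubset_iff_of_subset ?_).2 ⟨({l}, 0), ?_, ?_⟩)
    (finite_orthogonalPairs _)
  · rintro _ ⟨p, hp, rfl⟩
    rw [hl']
    exact raiseByOne_mem_orthogonalPairs hp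
  · simp [mem_orthogonalPairs]
    omega
  · rintro ⟨p, -, h⟩
    exact raiseByOne_ne_singleton_zero (by omega) p h
end

section
/- For all integers k ≥ 4 and n with n > 3k, one has d(k) < o(n). (This expresses that the number of nilpotent orbits in a Lie algebra of type D_k is smaller than the number of nilpotent orbits in any classical simple Lie algebra having an irreducible module of dimension n > 3k.) -/
/-- `o n` is the lower bound for the number of nilpotent adjoint orbits in a
classical simple Lie algebra having an (irreducible, self-dual as appropriate)
module of dimension `n`. -/
noncomputable def o (n : ℕ) : ℕ :=
  if Odd n then min (a (n - 1)) (b ((n - 1) / 2))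
  else min (a (n - 1)) (min (c (n / 2)) (d (n / 2)))

theorem card_subtype_lt_of_injOn {α β : Type*} {P : α → Prop} {Q : β → Prop} (f : α → β)
    (hf : ∀ x, P x → Q (f x)) (hinj : ∀ x y, P x → P y → f x = f y → x = y)
    (hfin : {y | Q y}.Finite) (y : β) (hy : Q y) (hne : ∀ x, P x → f x ≠ y) :
    Nat.card {x // P x} < Nat.card {y // Q y} := by
  have h1 : Nat.card {x // P x} = (f '' {x | P x}).ncard :=
    (Set.InjOn.ncard_image fun x hx z hz h => hinj x z hx hz h).symm
  rw [h1]
  refine Set.ncard_lt_ncard (t := {y | Q y}) ⟨?_, fun h => ?_⟩ hfin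
  · rintro _ ⟨x, hx, rfl⟩
    exact hf x hx
  · obtain ⟨x, hx, hxy⟩ := h hy
    exact hne x hx hxy

theorem finite_setOf_pos_sum_le (N : ℕ) :
    {l : Multiset ℕ | (∀ i ∈ l, 0 < i) ∧ l.sum ≤ N}.Finite := by
  refine ((Set.finite_Iic N).biUnion fun n _ =>
    Set.finite_range (Nat.Partition.parts (n := n))).subset ?_
  rintro l ⟨hpos, hsum⟩
  simp only [Set.mem_iUnion]
  exact ⟨l.sum, hsum, ⟨l, fun {i} hi => hpos i hi, rfl⟩, rfl⟩

theorem finite_setOf_pairs {Q : Multiset ℕ × Multiset ℕ → Prop} (N : ℕ)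
    (hQ : ∀ p, Q p → (∀ i ∈ p.1, 0 < i) ∧ (∀ i ∈ p.2, 0 < i) ∧ p.1.sum + p.2.sum ≤ N) :
    {p | Q p}.Finite := by
  refine ((finite_setOf_pos_sum_le N).prod (finite_setOf_pos_sum_le N)).subset fun p hp => ?_
  obtain ⟨h1, h2, h3⟩ := hQ p hp
  exact ⟨⟨h1, by omega⟩, ⟨h2, by omega⟩⟩

theorem pos_of_mem_add_replicate_one {l : Multiset ℕ} (hl : ∀ i ∈ l, 0 < i) (r : ℕ) :
    ∀ i ∈ l + Multiset.replicate r 1, 0 < i := by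
  intro i hi
  rcases Multiset.mem_add.1 hi with h | h
  · exact hl i h
  · rw [Multiset.eq_of_mem_replicate h]
    exact one_pos

theorem add_replicate_one_ne_singleton (l : Multiset ℕ) {r m : ℕ} (hr : 0 < r) (hm : 1 < m) :
    l + Multiset.replicate r 1 ≠ {m} := by
  intro h
  have h1 : (1 : ℕ) ∈ l + Multiset.replicate r 1 :=
    Multiset.mem_add.2 (Or.inr (Multiset.mem_replicate.2 ⟨hr.ne', rfl⟩))
  rw [h, Multiset.mem_singleton] at h1
  omega

theorem d_lt_numPartitions {k n : ℕ} (hk : 0 < k) (hn : 2 * k < n) :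
    d k < numPartitions n := by
  refine card_subtype_lt_of_injOn
    (fun p => p.1 + p.1 + p.2 + Multiset.replicate (n - 2 * k) 1) ?_ ?_ ?_ {n} ?_ ?_
  · rintro ⟨l, m⟩ ⟨hl, hm, -, -, hs⟩
    refine ⟨pos_of_mem_add_replicate_one ?_ _, ?_⟩
    · intro i hi
      simp only [Multiset.mem_add] at hi
      rcases hi with (h | h) | h
      exacts [hl i h, hl i h, hm i h]
    · simp only [Multiset.sum_add, Multiset.sum_replicate, smul_eq_mul] at hs ⊢
      omega
  · rintro ⟨l, m⟩ ⟨l', m'⟩ ⟨-, -, hm, -, -⟩ ⟨-, -, hm', -, -⟩ h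
    have h := add_right_cancel h
    have key : ∀ i, l.count i = l'.count i ∧ m.count i = m'.count i := by
      intro i
      have hi := congrArg (Multiset.count i) h
      have h1 := Multiset.nodup_iff_count_le_one.1 hm i
      have h2 := Multiset.nodup_iff_count_le_one.1 hm' i
      simp only [Multiset.count_add] at hi h1 h2
      omega
    exact Prod.ext (Multiset.ext.2 fun i => (key i).1) (Multiset.ext.2 fun i => (key i).2)
  · exact (finite_setOf_pos_sum_le n).subset fun l hl => ⟨hl.1, hl.2.le⟩
  · simp
    omega
  · exact fun p _ => add_replicate_one_ne_singleton _ (by omega) (by omega)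

theorem d_lt_d {k m : ℕ} (hk : 0 < k) (hm : k < m) : d k < d m := by
  refine card_subtype_lt_of_injOn
    (fun p => (p.1 + Multiset.replicate (m - k) 1, p.2)) ?_ ?_ ?_ ({m}, 0) ?_ ?_
  · rintro ⟨l, μ⟩ ⟨h1, h2, h3, h4, hs⟩
    refine ⟨pos_of_mem_add_replicate_one h1 _, h2, h3, h4, ?_⟩
    simp only [Multiset.sum_add, Multiset.sum_replicate, smul_eq_mul] at hs ⊢
    omega
  · rintro ⟨l, μ⟩ ⟨l', μ'⟩ - - h
    simpa using h
  · refine finite_setOf_pairs (2 * m) fun p hp => ⟨hp.1, hp.2.1, ?_⟩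
    have := hp.2.2.2.2
    omega
  · simp
    omega
  · exact fun p _ h =>
      add_replicate_one_ne_singleton _ (by omega) (by omega) (congrArg Prod.fst h)

theorem d_lt_b {k m : ℕ} (hk : 0 < k) (hm : k < m) : d k < b m := by
  refine card_subtype_lt_of_injOn
    (fun p => if 1 ∈ p.2 then (p.1 + Multiset.replicate (m - k + 1) 1, p.2.erase 1)
      else (p.1 + Multiset.replicate (m - k) 1, 1 ::ₘ p.2)) ?_ ?_ ?_ ({m}, {1}) ?_ ?_
  · rintro ⟨l, μ⟩ ⟨h1, h2, h3, h4, hs⟩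
    dsimp only at *
    split_ifs with h
    · refine ⟨pos_of_mem_add_replicate_one h1 _, fun i hi => h2 i (Multiset.mem_of_mem_erase hi),
        h3.erase 1, fun i hi => h4 i (Multiset.mem_of_mem_erase hi), ?_⟩
      have := Multiset.sum_erase h
      simp only [Multiset.sum_add, Multiset.sum_replicate, smul_eq_mul]
      omega
    · refine ⟨pos_of_mem_add_replicate_one h1 _, ?_, Multiset.nodup_cons.2 ⟨h, h3⟩, ?_, ?_⟩
      · intro i hi
        rcases Multiset.mem_cons.1 hi with rfl | hi
        exacts [one_pos, h2 i hi]
      · intro i hi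
        rcases Multiset.mem_cons.1 hi with rfl | hi
        exacts [odd_one, h4 i hi]
      · simp only [Multiset.sum_add, Multiset.sum_replicate, smul_eq_mul, Multiset.sum_cons]
        omega
  · rintro ⟨l, μ⟩ ⟨l', μ'⟩ ⟨-, -, h3, -, -⟩ ⟨-, -, h3', -, -⟩ h
    dsimp only at *
    split_ifs at h with h1 h2 h2
    · simp only [Prod.mk.injEq, add_left_inj] at h
      rw [h.1, ← Multiset.cons_erase h1, h.2, Multiset.cons_erase h2]
    · have h5 : 1 ∈ μ.erase 1 := by
        rw [(Prod.mk.inj h).2]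
        exact Multiset.mem_cons_self _ _
      exact absurd h5 h3.notMem_erase
    · have h5 : 1 ∈ μ'.erase 1 := by
        rw [← (Prod.mk.inj h).2]
        exact Multiset.mem_cons_self _ _
      exact absurd h5 h3'.notMem_erase
    · simpa using h
  · refine finite_setOf_pairs (2 * m + 1) fun p hp => ⟨hp.1, hp.2.1, ?_⟩
    have := hp.2.2.2.2
    omega
  · simp
    omega
  · intro p _ h
    split_ifs at h <;>
    exact add_replicate_one_ne_singleton _ (by omega) (by omega) (congrArg Prod.fst h)

theorem map_two_mul_add_one_map_half {μ : Multiset ℕ} (h : ∀ i ∈ μ, Odd i) :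
    (μ.map (· / 2)).map (2 * · + 1) = μ := by
  rw [Multiset.map_map]
  conv_rhs => rw [← Multiset.map_id μ]
  refine Multiset.map_congr rfl fun i hi => ?_
  obtain ⟨j, rfl⟩ := h i hi
  simp only [Function.comp_apply, id_eq]
  omega

theorem two_mul_sum_map_half_add_card {μ : Multiset ℕ} (h : ∀ i ∈ μ, Odd i) :
    2 * (μ.map (· / 2)).sum + μ.card = μ.sum := by
  conv_rhs => rw [← map_two_mul_add_one_map_half h]
  simp [Multiset.sum_map_add, Multiset.sum_map_mul_left]

theorem sum_erase_zero (s : Multiset ℕ) : (s.erase 0).sum = s.sum := by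
  by_cases h : 0 ∈ s
  · simpa using Multiset.sum_erase h
  · rw [Multiset.erase_of_notMem h]

theorem eq_of_erase_eq_of_even_card {α : Type*} [DecidableEq α] {s t : Multiset α} {x : α}
    (hs : Even s.card) (ht : Even t.card) (h : s.erase x = t.erase x) : s = t := by
  have hc := congrArg Multiset.card h
  by_cases h1 : x ∈ s <;> by_cases h2 : x ∈ t
  · rw [← Multiset.cons_erase h1, h, Multiset.cons_erase h2]
  · have := Multiset.card_erase_add_one h1
    rw [Multiset.erase_of_notMem h2] at hc
    grind
  · have := Multiset.card_erase_add_one h2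
    rw [Multiset.erase_of_notMem h1] at hc
    grind
  · rwa [Multiset.erase_of_notMem h1, Multiset.erase_of_notMem h2] at h

theorem d_lt_c {k m : ℕ} (hk : 0 < k) (hm : k < m) : d k < c m := by
  refine card_subtype_lt_of_injOn
    (fun p => (p.1 + Multiset.replicate (m - k + p.2.card / 2) 1, (p.2.map (· / 2)).erase 0))
    ?_ ?_ ?_ ({m}, 0) ?_ ?_
  · rintro ⟨l, μ⟩ ⟨h1, h2, h3, h4, hs⟩
    have hnd : (μ.map (· / 2)).Nodup :=
      Multiset.Nodup.of_map (2 * · + 1) (by rwa [map_two_mul_add_one_map_half h4])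
    refine ⟨pos_of_mem_add_replicate_one h1 _, fun i hi => ?_, hnd.erase 0, ?_⟩
    · exact Nat.pos_of_ne_zero (hnd.mem_erase_iff.1 hi).1
    · have : 2 * (μ.map (· / 2)).sum + μ.card = μ.sum := two_mul_sum_map_half_add_card h4
      simp only [Multiset.sum_add, Multiset.sum_replicate, smul_eq_mul, sum_erase_zero] at hs ⊢
      omega
  · have hev : ∀ p : Multiset ℕ × Multiset ℕ, (∀ i ∈ p.2, Odd i) →
        2 * p.1.sum + p.2.sum = 2 * k → Even (p.2.map (· / 2)).card := by
      intro p hp hs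
      have := two_mul_sum_map_half_add_card hp
      rw [Multiset.card_map, Nat.even_iff]
      omega
    rintro ⟨l, μ⟩ ⟨l', μ'⟩ ⟨-, -, -, h4, hs⟩ ⟨-, -, -, h4', hs'⟩ h
    obtain ⟨hl, hμ⟩ := Prod.mk.inj h
    have hμ' := congrArg (Multiset.map (2 * · + 1))
      (eq_of_erase_eq_of_even_card (hev _ h4 hs) (hev _ h4' hs') hμ)
    rw [map_two_mul_add_one_map_half h4, map_two_mul_add_one_map_half h4'] at hμ'
    dsimp only at hμ' hl
    subst hμ'
    rw [add_right_cancel hl]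
  · exact finite_setOf_pairs m fun p hp => ⟨hp.1, hp.2.1, hp.2.2.2.le⟩
  · simp
    omega
  · exact fun p _ h =>
      add_replicate_one_ne_singleton _ (by omega) (by omega) (congrArg Prod.fst h)

theorem stmt_9 : ∀ k n : ℕ, 4 ≤ k → 3 * k < n → d k < o n := by
  intro k n hk hn
  have ha : d k < a (n - 1) := by
    rw [a, Nat.sub_add_cancel (by omega)]
    exact d_lt_numPartitions (by omega) (by omega)
  unfold o
  split_ifs
  · exact lt_min ha (d_lt_b (by omega) (by omega))
  · exact lt_min ha (lt_min (d_lt_c (by omega) (by omega)) (d_lt_d (by omega) (by omega)))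
end

section
/- The kernel of the derivation δ₁ of R equals the ℂ-subalgebra of R generated by a₁ and a₂, and the algebra homomorphism ℂ[x, y] → R sending x ↦ a₁, y ↦ a₂ is injective (so Ker δ₁ is a polynomial ring in two variables; equivalently SL₂ // ℂ₊ ≅ ℂ² for the corresponding ℂ₊-action). Likewise, the kernel of δ₂ equals the ℂ-subalgebra generated by b₁ and b₂, which is a polynomial ring in b₁ and b₂. -/
open MvPolynomial

noncomputable section

/-- The polynomial ring ℂ[x₁, x₂, x₃, x₄]. -/
abbrev P : Type := MvPolynomial (Fin 4) ℂ

/-- The ideal (x₁x₄ − x₂x₃ − 1) of ℂ[x₁, x₂, x₃, x₄]. -/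
def relI : Ideal P := Ideal.span {X 0 * X 3 - X 1 * X 2 - 1}

/-- The coordinate ring R = ℂ[x₁, x₂, x₃, x₄]/(x₁x₄ − x₂x₃ − 1) of SL₂(ℂ). -/
abbrev R : Type := P ⧸ relI

/-- a₁, the image of x₁ in R. -/
def a1 : R := Ideal.Quotient.mk relI (X 0)
/-- a₂, the image of x₂ in R. -/
def a2 : R := Ideal.Quotient.mk relI (X 1)
/-- b₁, the image of x₃ in R. -/
def b1 : R := Ideal.Quotient.mk relI (X 2)
/-- b₂, the image of x₄ in R. -/
def b2 : R := Ideal.Quotient.mk relI (X 3)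

/-- The polynomial derivation D₁ = x₁ ∂/∂x₃ + x₂ ∂/∂x₄. -/
def D1 : Derivation ℂ P P := mkDerivation ℂ ![0, 0, X 0, X 1]

/-- The polynomial derivation D₂ = x₃ ∂/∂x₁ + x₄ ∂/∂x₂. -/
def D2 : Derivation ℂ P P := mkDerivation ℂ ![X 2, X 3, 0, 0]

end

/-- `u, v, s, t` generate the `ℂ`-algebra `S` with the single relation `u t - v s = c`, where
`c` is a nonzero constant (the universal property is only required for maps to fields). -/
structure IsUnimodularPresentation {S : Type} [CommRing S] [Algebra ℂ S]
    (c : ℂ) (u v s t : S) : Prop where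
  ne_zero : c ≠ 0
  rel : u * t - v * s = algebraMap ℂ S c
  adjoin_eq_top : Algebra.adjoin ℂ {u, v, s, t} = ⊤
  exists_lift : ∀ (K : Type) [Field K] [Algebra ℂ K] (x y z w : K),
    x * w - y * z = algebraMap ℂ K c →
      ∃ φ : S →ₐ[ℂ] K, φ u = x ∧ φ v = y ∧ φ s = z ∧ φ t = w

/-- Evaluation of polynomials over `ℂ[x, y]` at `x = u`, `y = v`, `T = s`. -/
noncomputable def sliceEval {S : Type} [CommRing S] [Algebra ℂ S] (u v s : S) :
    Polynomial (MvPolynomial (Fin 2) ℂ) →+* S :=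
  Polynomial.eval₂RingHom (aeval ![u, v] : MvPolynomial (Fin 2) ℂ →ₐ[ℂ] S).toRingHom s

section SliceEval

variable {S : Type} [CommRing S] [Algebra ℂ S] (u v s : S)

@[simp]
lemma sliceEval_X : sliceEval u v s Polynomial.X = s := by
  simp [sliceEval]

@[simp]
lemma sliceEval_C (p : MvPolynomial (Fin 2) ℂ) :
    sliceEval u v s (Polynomial.C p) = aeval ![u, v] p := by
  simp [sliceEval]

lemma derivation_aeval_eq_zero {u v : S} (δ : Derivation ℂ S S) (hu : δ u = 0) (hv : δ v = 0)
    (p : MvPolynomial (Fin 2) ℂ) : δ (aeval ![u, v] p) = 0 := by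
  induction p using MvPolynomial.induction_on with
  | C a => simp
  | add p q hp hq => simp [hp, hq]
  | mul_X p i hp => fin_cases i <;> simp [hp, hu, hv]

lemma derivation_sliceEval {u v s : S} (δ : Derivation ℂ S S) (hu : δ u = 0) (hv : δ v = 0)
    (hs : δ s = u) (g : Polynomial (MvPolynomial (Fin 2) ℂ)) :
    δ (sliceEval u v s g) = sliceEval u v s (Polynomial.C (X 0) * Polynomial.derivative g) := by
  induction g using Polynomial.induction_on' with
  | add p q hp hq => simp only [map_add, mul_add, hp, hq]
  | monomial n a =>
    rw [← Polynomial.C_mul_X_pow_eq_monomial]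
    simp [derivation_aeval_eq_zero δ hu hv, hs, Derivation.leibniz_pow, Polynomial.derivative_X_pow]
    ring

lemma aeval_pair_swap {u v : S} (p : MvPolynomial (Fin 2) ℂ) :
    aeval ![u, v] (rename (Equiv.swap 0 1) p) = aeval ![v, u] p := by
  rw [aeval_rename]
  congr 2
  funext i
  fin_cases i <;> simp

lemma range_aeval_pair {u v : S} :
    (aeval ![u, v] : MvPolynomial (Fin 2) ℂ →ₐ[ℂ] S).range = Algebra.adjoin ℂ {u, v} := by
  rw [← Algebra.adjoin_range_eq_range_aeval]
  simp [Set.pair_comm]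

end SliceEval

namespace IsUnimodularPresentation

variable {S : Type} [CommRing S] [Algebra ℂ S] {c : ℂ} {u v s t : S}

lemma swap (h : IsUnimodularPresentation c u v s t) :
    IsUnimodularPresentation (-c) v u t s where
  ne_zero := neg_ne_zero.mpr h.ne_zero
  rel := by rw [map_neg, ← h.rel]; ring
  adjoin_eq_top := by
    rw [← h.adjoin_eq_top]
    congr 1
    ext
    simp only [Set.mem_insert_iff, Set.mem_singleton_iff]
    tauto
  exists_lift K _ _ x y z w hw := by
    obtain ⟨φ, h1, h2, h3, h4⟩ := h.exists_lift K y x w z (by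
      rw [map_neg] at hw; linear_combination -hw)
    exact ⟨φ, h2, h1, h4, h3⟩

lemma transpose (h : IsUnimodularPresentation c u v s t) :
    IsUnimodularPresentation (-c) s t u v where
  ne_zero := neg_ne_zero.mpr h.ne_zero
  rel := by rw [map_neg, ← h.rel]; ring
  adjoin_eq_top := by
    rw [← h.adjoin_eq_top]
    congr 1
    ext
    simp only [Set.mem_insert_iff, Set.mem_singleton_iff]
    tauto
  exists_lift K _ _ x y z w hw := by
    obtain ⟨φ, h1, h2, h3, h4⟩ := h.exists_lift K z w x y (by
      rw [map_neg] at hw; linear_combination -hw)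
    exact ⟨φ, h3, h4, h1, h2⟩

lemma sliceEval_injective (h : IsUnimodularPresentation c u v s t) :
    Function.Injective (sliceEval u v s) := by
  let B := Polynomial (MvPolynomial (Fin 2) ℂ)
  let K := FractionRing B
  let ι : B →ₐ[ℂ] K := IsScalarTower.toAlgHom ℂ B K
  have hι : Function.Injective ι := IsFractionRing.injective B K
  have hx : ι (Polynomial.C (X 0)) ≠ 0 := by
    rw [map_ne_zero_iff _ hι, Polynomial.C_ne_zero]
    exact X_ne_zero 0
  obtain ⟨φ, h1, h2, h3, -⟩ := h.exists_lift K (ι (Polynomial.C (X 0))) (ι (Polynomial.C (X 1)))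
    (ι Polynomial.X)
    ((algebraMap ℂ K c + ι (Polynomial.C (X 1)) * ι Polynomial.X) / ι (Polynomial.C (X 0)))
    (by rw [mul_div_cancel₀ _ hx]; ring)
  have hA (p : MvPolynomial (Fin 2) ℂ) : φ (aeval ![u, v] p) = ι (Polynomial.C p) := by
    have : φ.comp (aeval ![u, v]) =
        ι.comp ((Algebra.ofId (MvPolynomial (Fin 2) ℂ) B).restrictScalars ℂ) := by
      ext i
      fin_cases i
      · simpa [B, Polynomial.algebraMap_eq] using h1
      · simpa [B, Polynomial.algebraMap_eq] using h2
    exact DFunLike.congr_fun this p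
  have hcomp : (φ : S →+* K).comp (sliceEval u v s) = (ι : B →+* K) := by
    refine Polynomial.ringHom_ext (fun p => ?_) ?_
    · simpa using hA p
    · simpa using h3
  refine Function.Injective.of_comp (f := φ) ?_
  have : (φ ∘ sliceEval u v s : B → K) = ι := funext fun g => DFunLike.congr_fun hcomp g
  rwa [this]

lemma aeval_injective (h : IsUnimodularPresentation c u v s t) :
    Function.Injective (aeval ![u, v] : MvPolynomial (Fin 2) ℂ →ₐ[ℂ] S) := by
  intro p q hpq
  rw [← sliceEval_C u v s, ← sliceEval_C u v s] at hpq
  exact Polynomial.C_injective (h.sliceEval_injective hpq)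

lemma exists_pow_mul_eq_sliceEval (h : IsUnimodularPresentation c u v s t) (f : S) :
    ∃ n g, u ^ n * f = sliceEval u v s g := by
  have hf : f ∈ Algebra.adjoin ℂ {u, v, s, t} := h.adjoin_eq_top ▸ Algebra.mem_top
  induction hf using Algebra.adjoin_induction with
  | mem x hx =>
    rcases hx with rfl | rfl | rfl | rfl
    · exact ⟨0, Polynomial.C (X 0), by simp⟩
    · exact ⟨0, Polynomial.C (X 1), by simp⟩
    · exact ⟨0, Polynomial.X, by simp⟩
    · refine ⟨1, Polynomial.C (C c) + Polynomial.C (X 1) * Polynomial.X, ?_⟩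
      rw [map_add, map_mul]
      simp only [sliceEval_C, sliceEval_X, aeval_C, aeval_X, ← h.rel, Matrix.cons_val_one,
        Matrix.cons_val_zero]
      ring
  | algebraMap r => exact ⟨0, Polynomial.C (C r), by simp⟩
  | add x y _ _ hx hy =>
    obtain ⟨n, p, hp⟩ := hx
    obtain ⟨m, q, hq⟩ := hy
    refine ⟨n + m, Polynomial.C (X 0 ^ m) * p + Polynomial.C (X 0 ^ n) * q, ?_⟩
    rw [map_add, map_mul, map_mul, ← hp, ← hq]
    simp only [sliceEval_C, map_pow, aeval_X, Matrix.cons_val_zero]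
    ring
  | mul x y _ _ hx hy =>
    obtain ⟨n, p, hp⟩ := hx
    obtain ⟨m, q, hq⟩ := hy
    refine ⟨n + m, p * q, ?_⟩
    rw [map_mul, ← hp, ← hq]
    ring

lemma exists_pow_mul_eq_aeval (h : IsUnimodularPresentation c u v s t) (δ : Derivation ℂ S S)
    (hu : δ u = 0) (hv : δ v = 0) (hs : δ s = u) {f : S} (hf : δ f = 0) :
    ∃ (n : ℕ) (p : MvPolynomial (Fin 2) ℂ), u ^ n * f = aeval ![u, v] p := by
  obtain ⟨n, g, hg⟩ := h.exists_pow_mul_eq_sliceEval f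
  have h0 : sliceEval u v s (Polynomial.C (X 0) * Polynomial.derivative g) = 0 := by
    rw [← derivation_sliceEval δ hu hv hs, ← hg]
    simp [Derivation.leibniz_pow, hu, hf]
  rw [map_eq_zero_iff _ h.sliceEval_injective, mul_eq_zero, Polynomial.C_eq_zero] at h0
  have hd := Polynomial.derivative_eq_zero.mp (h0.resolve_left (X_ne_zero 0))
  refine ⟨n, g.coeff 0, ?_⟩
  rw [hg, ← sliceEval_C u v s, ← Polynomial.eq_C_of_natDegree_eq_zero hd]

lemma isCoprime (h : IsUnimodularPresentation c u v s t) : IsCoprime u v := by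
  refine ⟨algebraMap ℂ S c⁻¹ * t, -(algebraMap ℂ S c⁻¹ * s), ?_⟩
  have hc : algebraMap ℂ S c⁻¹ * algebraMap ℂ S c = 1 := by
    rw [← map_mul, inv_mul_cancel₀ h.ne_zero, map_one]
  rw [← h.rel] at hc
  linear_combination hc

theorem ker_eq_adjoin (h : IsUnimodularPresentation c u v s t) (δ : Derivation ℂ S S)
    (hu : δ u = 0) (hv : δ v = 0) (hs : δ s = u) (ht : δ t = v) :
    {r : S | δ r = 0} = (Algebra.adjoin ℂ {u, v} : Subalgebra ℂ S) := by
  rw [← range_aeval_pair]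
  ext f
  constructor
  · intro hf
    obtain ⟨n, p, hp⟩ := h.exists_pow_mul_eq_aeval δ hu hv hs hf
    obtain ⟨m, q, hq⟩ := h.swap.exists_pow_mul_eq_aeval δ hv hu ht hf
    rw [← aeval_pair_swap] at hq
    set q' := rename (Equiv.swap 0 1) q
    have hpq : X 1 ^ m * p = X 0 ^ n * q' := by
      apply h.aeval_injective
      rw [map_mul, map_mul, ← hp, ← hq]
      simp only [map_pow, aeval_X, Matrix.cons_val_zero, Matrix.cons_val_one]
      ring
    have hrel : IsRelPrime (X 0 ^ n : MvPolynomial (Fin 2) ℂ) (X 1 ^ m) := by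
      refine IsRelPrime.pow ?_
      rw [(X_prime (R := ℂ) (i := (0 : Fin 2))).irreducible.isRelPrime_iff_not_dvd, X_dvd_X]
      simp
    obtain ⟨r, rfl⟩ := hrel.dvd_of_dvd_mul_left ⟨q', hpq⟩
    have hqr : q' = X 1 ^ m * r := by
      refine mul_left_cancel₀ (pow_ne_zero n (X_ne_zero (R := ℂ) (0 : Fin 2))) ?_
      rw [← hpq]
      ring
    rw [hqr] at hq
    simp only [map_mul, map_pow, aeval_X, Matrix.cons_val_zero, Matrix.cons_val_one] at hp hq
    refine ⟨r, ?_⟩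
    obtain ⟨x, y, hxy⟩ := h.isCoprime.pow (m := n) (n := m)
    change aeval ![u, v] r = f
    linear_combination (aeval ![u, v] r - f) * (-hxy) - x * hp - y * hq
  · rintro ⟨p, rfl⟩
    exact derivation_aeval_eq_zero δ hu hv p

end IsUnimodularPresentation

lemma isUnimodularPresentation_R : IsUnimodularPresentation 1 a1 a2 b1 b2 where
  ne_zero := one_ne_zero
  rel := by
    rw [map_one, ← sub_eq_zero]
    change Ideal.Quotient.mk relI (X 0 * X 3 - X 1 * X 2 - 1) = 0
    exact Ideal.Quotient.eq_zero_iff_mem.mpr (Ideal.subset_span rfl)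
  adjoin_eq_top := by
    have hsurj : Function.Surjective (Ideal.Quotient.mkₐ ℂ relI) :=
      Ideal.Quotient.mkₐ_surjective ℂ relI
    rw [← (AlgHom.range_eq_top _).mpr hsurj, ← Algebra.map_top, ← MvPolynomial.adjoin_range_X,
      AlgHom.map_adjoin]
    congr 1
    ext r
    simp [Fin.exists_fin_succ, a1, a2, b1, b2, eq_comm]
  exists_lift K _ _ x y z w hw := by
    refine ⟨Ideal.Quotient.liftₐ relI (aeval ![x, y, z, w]) fun p hp => ?_, ?_, ?_, ?_, ?_⟩
    · have hle : relI ≤ RingHom.ker (aeval ![x, y, z, w] : P →ₐ[ℂ] K) := by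
        rw [relI, Ideal.span_singleton_le_iff_mem, RingHom.mem_ker]
        simp [hw]
      exact hle hp
    · exact (aeval_X _ _)
    · exact (aeval_X _ _)
    · exact (aeval_X _ _)
    · exact (aeval_X _ _)

/-- Ker δ₁ is the subalgebra generated by a₁, a₂ and is a polynomial ring in two
variables (the map ℂ[x,y] → R, x ↦ a₁, y ↦ a₂ is injective); likewise Ker δ₂ is
the subalgebra generated by b₁, b₂, a polynomial ring in b₁, b₂. -/
theorem stmt_12 (δ1 δ2 : Derivation ℂ R R)
    (h1 : ∀ p : P, δ1 (Ideal.Quotient.mk relI p) = Ideal.Quotient.mk relI (D1 p))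
    (h2 : ∀ p : P, δ2 (Ideal.Quotient.mk relI p) = Ideal.Quotient.mk relI (D2 p)) :
    {r : R | δ1 r = 0} = (Algebra.adjoin ℂ {a1, a2} : Subalgebra ℂ R) ∧
    Function.Injective (MvPolynomial.aeval ![a1, a2] : MvPolynomial (Fin 2) ℂ →ₐ[ℂ] R) ∧
    {r : R | δ2 r = 0} = (Algebra.adjoin ℂ {b1, b2} : Subalgebra ℂ R) ∧
    Function.Injective (MvPolynomial.aeval ![b1, b2] : MvPolynomial (Fin 2) ℂ →ₐ[ℂ] R) := by
  have h := isUnimodularPresentation_R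
  refine ⟨h.ker_eq_adjoin δ1 ?_ ?_ ?_ ?_, h.aeval_injective,
    h.transpose.ker_eq_adjoin δ2 ?_ ?_ ?_ ?_, h.transpose.aeval_injective⟩
  all_goals first
    | exact (h1 _).trans (by simp [D1, mkDerivation_X, a1, a2])
    | exact (h2 _).trans (by simp [D2, mkDerivation_X, b1, b2])
end

section
/- The derivations δ₁ and δ₂ of R are semi-compatible; in fact the ℂ-linear span of the set of products { f·g : f belongs to the ℂ-subalgebra of R generated by a₁ and a₂ (= Ker δ₁), and g belongs to the ℂ-subalgebra generated by b₁ and b₂ (= Ker δ₂) } is all of R; in particular it contains a nonzero ideal of R. -/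
open MvPolynomial

theorem relI_ne_top : relI ≠ ⊤ := by
  intro h
  have hle : relI ≤ RingHom.ker (aeval (![1, 0, 0, 1] : Fin 4 → ℂ)) := by
    rw [relI, Ideal.span_singleton_le_iff_mem, RingHom.mem_ker]
    simp
  rw [h, top_le_iff] at hle
  exact RingHom.ker_ne_top _ hle

theorem adjoin_entries_eq_top :
    Algebra.adjoin ℂ ({a1, a2} ∪ {b1, b2} : Set R) = ⊤ := by
  have hX : (Ideal.Quotient.mkₐ ℂ relI) '' Set.range X ⊆ ({a1, a2} ∪ {b1, b2} : Set R) := by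
    rintro _ ⟨_, ⟨i, rfl⟩, rfl⟩
    fin_cases i
    · exact .inl (.inl rfl)
    · exact .inl (.inr rfl)
    · exact .inr (.inl rfl)
    · exact .inr (.inr rfl)
  rw [eq_top_iff, ← AlgHom.range_eq_top _ |>.mpr (Ideal.Quotient.mkₐ_surjective ℂ relI),
    ← Algebra.map_top, ← adjoin_range_X, AlgHom.map_adjoin]
  exact Algebra.adjoin_mono hX

/-- The products of elements of `ℂ[a₁, a₂]` and `ℂ[b₁, b₂]` span `R`. -/
theorem span_products_eq_top :
    Submodule.span ℂ {r : R | ∃ f ∈ Algebra.adjoin ℂ {a1, a2},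
      ∃ g ∈ Algebra.adjoin ℂ {b1, b2}, r = f * g} = ⊤ := by
  have hmul := Algebra.adjoin_union_coe_submodule ℂ ({a1, a2} : Set R) {b1, b2}
  rw [adjoin_entries_eq_top, Algebra.top_toSubmodule] at hmul
  rw [eq_top_iff, hmul, Submodule.mul_le]
  exact fun f hf g hg => Submodule.subset_span ⟨f, hf, g, hg, rfl⟩

/-- The ℂ-linear span of products of elements of Ker δ₁ = ℂ[a₁,a₂] and
Ker δ₂ = ℂ[b₁,b₂] is all of R; in particular it contains a nonzero ideal of R,
i.e. δ₁ and δ₂ are semi-compatible. -/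
theorem stmt_14 :
    Submodule.span ℂ {r : R | ∃ f ∈ Algebra.adjoin ℂ {a1, a2},
      ∃ g ∈ Algebra.adjoin ℂ {b1, b2}, r = f * g} = ⊤ ∧
    ∃ J : Ideal R, J ≠ ⊥ ∧
      (J : Set R) ⊆ (Submodule.span ℂ {r : R | ∃ f ∈ Algebra.adjoin ℂ {a1, a2},
        ∃ g ∈ Algebra.adjoin ℂ {b1, b2}, r = f * g} : Set R) := by
  have : Nontrivial R := Ideal.Quotient.nontrivial_iff.mpr relI_ne_top
  refine ⟨span_products_eq_top, ⊤, top_ne_bot, ?_⟩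
  rw [span_products_eq_top]
  exact Set.subset_univ _
end

section
/- Let Ψ : ℂ[U, V, Z] → R be the ℂ-algebra homomorphism with Ψ(U) = a₁a₂, Ψ(V) = b₁b₂ and Ψ(Z) = a₂b₁ + 1/2. Then the kernel of Ψ is the principal ideal generated by UV − Z² + 1/4. Consequently the image of Ψ is isomorphic as a ℂ-algebra to ℂ[U,V,Z]/(UV − Z² + 1/4), the coordinate ring of the smooth affine hypersurface S ⊂ ℂ³ given by uv = z² − 1/4; this realizes the isomorphism SL₂/ℂ* ≅ S, where ℂ* is the diagonal subgroup of SL₂. -/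
open MvPolynomial

/-- The homomorphism Ψ : ℂ[U,V,Z] → R, U ↦ a₁a₂, V ↦ b₁b₂, Z ↦ a₂b₁ + 1/2. -/
noncomputable def Psi : MvPolynomial (Fin 3) ℂ →ₐ[ℂ] R :=
  MvPolynomial.aeval ![a1 * a2, b1 * b2, a2 * b1 + algebraMap ℂ R (1 / 2)]

/-- The polynomial UV − Z² + 1/4 is irreducible. -/
lemma irreducible_surface :
    Irreducible (X 0 * X 1 - X 2 ^ 2 + C (1 / 4) : MvPolynomial (Fin 3) ℂ) := by
  have h := irreducible_mul_X_add (X 0 : MvPolynomial (Fin 3) ℂ) (C (1 / 4) - X 2 ^ 2) 1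
    (X_ne_zero 0) (by simp [vars_X]) ?_ ?_
  · convert h using 1
    ring
  · intro h
    have h' := vars_sub_subset _ h
    have h'' : (1 : Fin 3) ∈ (X 2 : MvPolynomial (Fin 3) ℂ).vars := by
      rw [vars_C, Finset.empty_union] at h'
      exact vars_pow _ _ h'
    simp [vars_X] at h''
  · rw [(X_prime (R := ℂ) (i := (0 : Fin 3))).irreducible.isRelPrime_iff_not_dvd]
    rintro ⟨q, hq⟩
    have := congrArg (eval (0 : Fin 3 → ℂ)) hq
    simp at this

/-- A matrix of determinant one gives a ℂ-point of R. -/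
noncomputable def pointOfDet (a₁ a₂ c₁ c₂ : ℂ) (h : a₁ * c₂ - a₂ * c₁ = 1) : R →ₐ[ℂ] ℂ :=
  Ideal.Quotient.liftₐ relI (aeval ![a₁, a₂, c₁, c₂]) fun p hp => by
    have hle : relI ≤ RingHom.ker (aeval ![a₁, a₂, c₁, c₂] : P →ₐ[ℂ] ℂ) := by
      rw [relI, Ideal.span_singleton_le_iff_mem, RingHom.mem_ker]
      simp [h]
    exact hle hp

lemma pointOfDet_Psi {a₁ a₂ c₁ c₂ : ℂ} (h : a₁ * c₂ - a₂ * c₁ = 1)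
    (f : MvPolynomial (Fin 3) ℂ) :
    pointOfDet a₁ a₂ c₁ c₂ h (Psi f) = aeval ![a₁ * a₂, c₁ * c₂, a₂ * c₁ + 1 / 2] f := by
  have hmk (p : P) : pointOfDet a₁ a₂ c₁ c₂ h (Ideal.Quotient.mk relI p) =
      aeval ![a₁, a₂, c₁, c₂] p := rfl
  suffices (pointOfDet a₁ a₂ c₁ c₂ h).comp Psi =
      aeval ![a₁ * a₂, c₁ * c₂, a₂ * c₁ + 1 / 2] from DFunLike.congr_fun this f
  ext i
  rw [AlgHom.comp_apply, Psi, aeval_X, aeval_X]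
  fin_cases i
  · simp [a1, a2, hmk]
  · simp [b1, b2, hmk]
  · change pointOfDet a₁ a₂ c₁ c₂ h (a2 * b1 + algebraMap ℂ R (1 / 2)) = a₂ * c₁ + 1 / 2
    rw [map_add, AlgHom.commutes, map_mul, a2, b1, hmk, hmk]
    simp

/-- Every point of the surface uv = z² − 1/4 is the image of a matrix of determinant one. -/
lemma exists_det_eq_one {u v z : ℂ} (h : u * v - z ^ 2 + 1 / 4 = 0) :
    ∃ a₁ a₂ c₁ c₂ : ℂ, a₁ * c₂ - a₂ * c₁ = 1 ∧
      a₁ * a₂ = u ∧ c₁ * c₂ = v ∧ a₂ * c₁ + 1 / 2 = z := by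
  by_cases hu : u = 0
  · subst hu
    have hz : (z - 1 / 2) * (z + 1 / 2) = 0 := by linear_combination -h
    rcases mul_eq_zero.mp hz with hz | hz
    · exact ⟨1, 0, v, 1, by ring, by ring, by ring, by linear_combination -hz⟩
    · exact ⟨0, 1, -1, -v, by ring, by ring, by ring, by linear_combination -hz⟩
  · refine ⟨1, u, (z - 1 / 2) / u, z + 1 / 2, ?_, ?_, ?_, ?_⟩
    · field_simp
      ring
    · ring
    · field_simp
      linear_combination -4 * h
    · field_simp
      ring

lemma a1_mul_b2_sub_a2_mul_b1 : a1 * b2 - a2 * b1 = 1 := by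
  have h : Ideal.Quotient.mk relI (X 0 * X 3 - X 1 * X 2 - 1) = 0 :=
    Ideal.Quotient.eq_zero_iff_mem.mpr (Ideal.mem_span_singleton_self _)
  rw [map_sub, map_sub, map_mul, map_mul, map_one] at h
  exact sub_eq_zero.mp h

lemma Psi_surface : Psi (X 0 * X 1 - X 2 ^ 2 + C (1 / 4)) = 0 := by
  have h4 : algebraMap ℂ R (1 / 4) = algebraMap ℂ R (1 / 2) ^ 2 := by
    rw [← map_pow]
    norm_num
  have h2 : 2 * algebraMap ℂ R (1 / 2) = 1 := by
    rw [← map_ofNat (algebraMap ℂ R) 2, ← map_mul]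
    norm_num
  have hPsi : Psi (X 0 * X 1 - X 2 ^ 2 + C (1 / 4)) = a1 * a2 * (b1 * b2) -
      (a2 * b1 + algebraMap ℂ R (1 / 2)) ^ 2 + algebraMap ℂ R (1 / 4) := by
    simp only [Psi, map_add, map_sub, map_mul, map_pow, aeval_X, aeval_C]
    rfl
  rw [hPsi, h4]
  linear_combination a2 * b1 * a1_mul_b2_sub_a2_mul_b1 - a2 * b1 * h2

lemma ker_Psi : RingHom.ker (Psi : MvPolynomial (Fin 3) ℂ →ₐ[ℂ] R) =
    Ideal.span {(X 0 * X 1 - X 2 ^ 2 + C (1 / 4) : MvPolynomial (Fin 3) ℂ)} := by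
  apply le_antisymm
  · intro f hf
    have : (Ideal.span
        {(X 0 * X 1 - X 2 ^ 2 + C (1 / 4) : MvPolynomial (Fin 3) ℂ)}).IsPrime :=
      (Ideal.span_singleton_prime irreducible_surface.ne_zero).mpr irreducible_surface.prime
    rw [← IsPrime.vanishingIdeal_zeroLocus (K := ℂ) (Ideal.span _), mem_vanishingIdeal_iff]
    intro x hx
    have hx' : x 0 * x 1 - x 2 ^ 2 + 1 / 4 = 0 := by
      simpa using hx _ (Ideal.mem_span_singleton_self _)
    obtain ⟨a₁, a₂, c₁, c₂, h, hu, hv, hz⟩ := exists_det_eq_one hx'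
    have hpt := pointOfDet_Psi h f
    rw [RingHom.mem_ker.mp hf, map_zero, hu, hv, hz] at hpt
    have hxe : ![x 0, x 1, x 2] = x := by
      ext i
      fin_cases i <;> rfl
    rw [← hxe]
    exact hpt.symm
  · rw [Ideal.span_singleton_le_iff_mem, RingHom.mem_ker]
    exact Psi_surface

/-- Ker Ψ is the principal ideal (UV − Z² + 1/4); consequently the image of Ψ is
isomorphic to ℂ[U,V,Z]/(UV − Z² + 1/4), the coordinate ring of the surface
uv = z² − 1/4, realizing SL₂/ℂ* ≅ S. -/
theorem stmt_15 :
    RingHom.ker (Psi : MvPolynomial (Fin 3) ℂ →ₐ[ℂ] R) =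
      Ideal.span {(X 0 * X 1 - X 2 ^ 2 + C (1 / 4) : MvPolynomial (Fin 3) ℂ)} ∧
    Nonempty ((MvPolynomial (Fin 3) ℂ ⧸
        Ideal.span {(X 0 * X 1 - X 2 ^ 2 + C (1 / 4) : MvPolynomial (Fin 3) ℂ)})
      ≃ₐ[ℂ] Psi.range) := by
  exact ⟨ker_Psi, ⟨(Ideal.quotientEquivAlgOfEq ℂ ker_Psi.symm).trans
    (Ideal.quotientKerEquivRange Psi)⟩⟩
end

section
/- For each λ ∈ ℂ* the ℂ-algebra endomorphism of ℂ[x₁,x₂,x₃,x₄] determined by x₁ ↦ λ⁻¹x₁, x₂ ↦ λx₂, x₃ ↦ λ⁻¹x₃, x₄ ↦ λx₄ maps the ideal (x₁x₄ − x₂x₃ − 1) into itself and therefore induces a ℂ-algebra automorphism φ_λ of R (this is the action of the diagonal ℂ*-subgroup of SL₂ by right multiplication). The subalgebra of invariants { r ∈ R : φ_λ(r) = r for all λ ∈ ℂ* } equals the ℂ-subalgebra of R generated by the three elements u = a₁a₂, v = b₁b₂ and z = a₂b₁ + 1/2. -/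
open MvPolynomial

/-- For λ ∈ ℂ*, the endomorphism of ℂ[x₁,x₂,x₃,x₄] given by
x₁ ↦ λ⁻¹x₁, x₂ ↦ λx₂, x₃ ↦ λ⁻¹x₃, x₄ ↦ λx₄ (the right action of the diagonal
torus of SL₂). -/
noncomputable def Phi (l : ℂˣ) : P →ₐ[ℂ] P :=
  MvPolynomial.aeval
    ![C ((l⁻¹ : ℂˣ) : ℂ) * X 0, C (l : ℂ) * X 1, C ((l⁻¹ : ℂˣ) : ℂ) * X 2, C (l : ℂ) * X 3]

lemma Phi_relator (l : ℂˣ) :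
    Phi l (X 0 * X 3 - X 1 * X 2 - 1) = X 0 * X 3 - X 1 * X 2 - 1 := by
  have h : (C ((l⁻¹ : ℂˣ) : ℂ) : P) * C (l : ℂ) = 1 := by
    rw [← C_mul, ← Units.val_mul, inv_mul_cancel, Units.val_one, C_1]
  simp only [Phi, map_sub, map_mul, map_one, aeval_X, Matrix.cons_val]
  linear_combination (X 0 * X 3 - X 1 * X 2) * h

lemma Phi_mem_relI (l : ℂˣ) (p : P) (hp : p ∈ relI) : Phi l p ∈ relI := by
  obtain ⟨q, rfl⟩ := Ideal.mem_span_singleton.mp hp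
  rw [map_mul, Phi_relator]
  exact Ideal.mul_mem_right _ _ (Ideal.mem_span_singleton_self _)

lemma Phi_Phi_of_mul_eq_one {l m : ℂˣ} (h : l * m = 1) (p : P) : Phi l (Phi m p) = p := by
  obtain rfl : m = l⁻¹ := eq_inv_of_mul_eq_one_right h
  have hC : (C ((l⁻¹ : ℂˣ) : ℂ) : P) * C (l : ℂ) = 1 := by
    rw [← C_mul, ← Units.val_mul, inv_mul_cancel, Units.val_one, C_1]
  suffices (Phi l).comp (Phi l⁻¹) = AlgHom.id ℂ P from DFunLike.congr_fun this p
  ext1 i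
  have hl (c : ℂ) : Phi l (C c) = C c := (Phi l).commutes c
  have hX : Phi l⁻¹ (X i) = ![C (l : ℂ) * X 0, C ((l⁻¹ : ℂˣ) : ℂ) * X 1, C (l : ℂ) * X 2,
      C ((l⁻¹ : ℂˣ) : ℂ) * X 3] i := by
    simp only [Phi, aeval_X, inv_inv]
  rw [AlgHom.comp_apply, hX, AlgHom.id_apply]
  fin_cases i <;>
    simp only [Fin.zero_eta, Fin.mk_one, Fin.reduceFinMk, Matrix.cons_val, map_mul, hl] <;>
    simp only [Phi, aeval_X, Matrix.cons_val]
  · linear_combination X 0 * hC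
  · linear_combination X 1 * hC
  · linear_combination X 2 * hC
  · linear_combination X 3 * hC

/-- The endomorphism of `R` induced by `Phi l`. -/
noncomputable def phiHom (l : ℂˣ) : R →ₐ[ℂ] R :=
  Ideal.quotientMapₐ relI (Phi l) (fun p hp => Phi_mem_relI l p hp)

lemma phiHom_mk (l : ℂˣ) (p : P) :
    phiHom l (Ideal.Quotient.mk relI p) = Ideal.Quotient.mk relI (Phi l p) := rfl

lemma phiHom_comp_of_mul_eq_one {l m : ℂˣ} (h : l * m = 1) :
    (phiHom l).comp (phiHom m) = AlgHom.id ℂ R := by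
  ext r
  obtain ⟨p, rfl⟩ := Ideal.Quotient.mk_surjective r
  rw [AlgHom.comp_apply, phiHom_mk, phiHom_mk, Phi_Phi_of_mul_eq_one h, AlgHom.id_apply]

/-- The automorphism of `R` induced by `Phi l`. -/
noncomputable def phi (l : ℂˣ) : R ≃ₐ[ℂ] R :=
  AlgEquiv.ofAlgHom (phiHom l) (phiHom l⁻¹)
    (phiHom_comp_of_mul_eq_one (mul_inv_cancel l)) (phiHom_comp_of_mul_eq_one (inv_mul_cancel l))

lemma phi_mk (l : ℂˣ) (p : P) :
    phi l (Ideal.Quotient.mk relI p) = Ideal.Quotient.mk relI (Phi l p) := rfl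

lemma phi_a1 (l : ℂˣ) : phi l a1 = algebraMap ℂ R ((l⁻¹ : ℂˣ) : ℂ) * a1 := by
  rw [a1, phi_mk, Phi, aeval_X]
  rfl

lemma phi_a2 (l : ℂˣ) : phi l a2 = algebraMap ℂ R l * a2 := by
  rw [a2, phi_mk, Phi, aeval_X]
  rfl

lemma phi_b1 (l : ℂˣ) : phi l b1 = algebraMap ℂ R ((l⁻¹ : ℂˣ) : ℂ) * b1 := by
  rw [b1, phi_mk, Phi, aeval_X]
  rfl

lemma phi_b2 (l : ℂˣ) : phi l b2 = algebraMap ℂ R l * b2 := by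
  rw [b2, phi_mk, Phi, aeval_X]
  rfl

lemma a1_mul_b2 : a1 * b2 = a2 * b1 + 1 := by
  have h : Ideal.Quotient.mk relI (X 0 * X 3 - X 1 * X 2 - 1) = 0 :=
    Ideal.Quotient.eq_zero_iff_mem.mpr (Ideal.mem_span_singleton_self _)
  simp only [map_sub, map_mul, map_one] at h
  simp only [a1, a2, b1, b2]
  linear_combination h

/-- The subalgebra generated by `u`, `v` and `z`. -/
noncomputable abbrev uvz : Subalgebra ℂ R :=
  Algebra.adjoin ℂ {a1 * a2, b1 * b2, a2 * b1 + algebraMap ℂ R (1 / 2)}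

lemma a1_mul_a2_mem : a1 * a2 ∈ uvz := Algebra.subset_adjoin (by simp)

lemma b1_mul_b2_mem : b1 * b2 ∈ uvz := Algebra.subset_adjoin (by simp)

lemma a2_mul_b1_mem : a2 * b1 ∈ uvz := by
  have h : a2 * b1 + algebraMap ℂ R (1 / 2) ∈ uvz := Algebra.subset_adjoin (by simp)
  simpa only [add_sub_cancel_right] using sub_mem h (uvz.algebraMap_mem (1 / 2))

lemma a1_mul_b2_mem : a1 * b2 ∈ uvz := by
  rw [a1_mul_b2]
  exact add_mem a2_mul_b1_mem (one_mem _)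

lemma monomial_mem_uvz (a b c d : ℕ) (h : a + c = b + d) :
    a1 ^ a * a2 ^ b * b1 ^ c * b2 ^ d ∈ uvz := by
  induction hn : a + c generalizing a b c d with
  | zero =>
    obtain ⟨rfl, rfl, rfl, rfl⟩ : a = 0 ∧ b = 0 ∧ c = 0 ∧ d = 0 := by omega
    simp only [pow_zero, mul_one]
    exact one_mem _
  | succ n ih =>
    rcases a with _ | a
    · obtain ⟨c, rfl⟩ : ∃ k, c = k + 1 := ⟨c - 1, by omega⟩
      rcases b with _ | b
      · obtain ⟨d, rfl⟩ : ∃ k, d = k + 1 := ⟨d - 1, by omega⟩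
        convert mul_mem b1_mul_b2_mem (ih 0 0 c d (by omega) (by omega)) using 1
        ring
      · convert mul_mem a2_mul_b1_mem (ih 0 b c d (by omega) (by omega)) using 1
        ring
    · rcases b with _ | b
      · obtain ⟨d, rfl⟩ : ∃ k, d = k + 1 := ⟨d - 1, by omega⟩
        convert mul_mem a1_mul_b2_mem (ih a 0 c d (by omega) (by omega)) using 1
        ring
      · convert mul_mem a1_mul_a2_mem (ih a b c d (by omega) (by omega)) using 1
        ring

lemma smul_eq_algebraMap_mul (c : ℂ) (r : R) : c • r = algebraMap ℂ R c * r :=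
  Algebra.smul_def c r

lemma phi_monomial (l : ℂˣ) (a b c d : ℕ) :
    phi l (a1 ^ a * a2 ^ b * b1 ^ c * b2 ^ d) =
      ((l ^ ((b + d : ℤ) - (a + c)) : ℂˣ) : ℂ) • (a1 ^ a * a2 ^ b * b1 ^ c * b2 ^ d) := by
  have h : ((l ^ ((b + d : ℤ) - (a + c)) : ℂˣ) : ℂ) =
      ((l⁻¹ : ℂˣ) : ℂ) ^ (a + c) * (l : ℂ) ^ (b + d) := by
    rw [← Units.val_pow_eq_pow_val, ← Units.val_pow_eq_pow_val, ← Units.val_mul]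
    congr 1
    rw [zpow_sub, mul_comm, inv_pow]
    norm_cast
  rw [h, smul_eq_algebraMap_mul]
  simp only [map_mul, map_pow, phi_a1, phi_a2, phi_b1, phi_b2]
  ring

lemma phi_eq_self_of_mem_uvz (l : ℂˣ) {r : R} (hr : r ∈ uvz) : phi l r = r := by
  have hinv (a b c d : ℕ) (h : a + c = b + d) :
      phi l (a1 ^ a * a2 ^ b * b1 ^ c * b2 ^ d) = a1 ^ a * a2 ^ b * b1 ^ c * b2 ^ d := by
    rw [phi_monomial, show (b + d : ℤ) - (a + c) = 0 by omega, zpow_zero, Units.val_one, one_smul]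
  suffices uvz ≤ AlgHom.equalizer (phi l : R →ₐ[ℂ] R) (AlgHom.id ℂ R) from this hr
  refine Algebra.adjoin_le ?_
  rintro _ (rfl | rfl | rfl)
  · simpa using hinv 1 1 0 0 rfl
  · simpa using hinv 0 0 1 1 rfl
  · have := hinv 0 1 1 0 rfl
    simp only [pow_zero, pow_one, one_mul, mul_one] at this
    change phi l (a2 * b1 + algebraMap ℂ R (1 / 2)) = a2 * b1 + algebraMap ℂ R (1 / 2)
    rw [map_add, this, AlgEquiv.commutes]

lemma mem_uvz_sup_iSup_eigenspace (l : ℂˣ) (hl : ∀ k : ℤ, l ^ k = 1 → k = 0) (r : R) :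
    r ∈ Subalgebra.toSubmodule uvz ⊔
      ⨆ μ : ℂ, ⨆ _ : μ ≠ 1, Module.End.eigenspace (phi l).toLinearMap μ := by
  obtain ⟨p, rfl⟩ := Ideal.Quotient.mk_surjective r
  induction p using MvPolynomial.induction_on' with
  | add p q hp hq =>
    rw [map_add]
    exact add_mem hp hq
  | monomial m t =>
    have hm : Ideal.Quotient.mk relI (monomial m t) =
        t • (a1 ^ m 0 * a2 ^ m 1 * b1 ^ m 2 * b2 ^ m 3) := by
      rw [monomial_eq, Finsupp.prod_fintype _ _ (fun _ => pow_zero _), Fin.prod_univ_four,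
        smul_eq_algebraMap_mul]
      simp only [map_mul, map_pow]
      rfl
    rw [hm]
    refine Submodule.smul_mem _ _ ?_
    by_cases h : m 0 + m 2 = m 1 + m 3
    · exact Submodule.mem_sup_left (monomial_mem_uvz _ _ _ _ h)
    · refine Submodule.mem_sup_right (Submodule.mem_iSup_of_mem _ (Submodule.mem_iSup_of_mem ?_
        (Module.End.mem_eigenspace_iff.mpr (phi_monomial l _ _ _ _))))
      intro h1
      have := hl _ (Units.val_eq_one.mp h1)
      omega

lemma mem_uvz_of_phi_eq_self (l : ℂˣ) (hl : ∀ k : ℤ, l ^ k = 1 → k = 0) {r : R}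
    (hr : phi l r = r) : r ∈ uvz := by
  obtain ⟨s, hs, t, ht, rfl⟩ := Submodule.mem_sup.mp (mem_uvz_sup_iSup_eigenspace l hl r)
  have hfix : phi l t = t := by
    rw [map_add, phi_eq_self_of_mem_uvz l hs] at hr
    exact add_left_cancel hr
  have hdisj := Module.End.eigenspaces_iSupIndep (phi l).toLinearMap 1
  have ht0 : t = 0 := Submodule.disjoint_def.mp hdisj t
    (Module.End.mem_eigenspace_iff.mpr (by simpa using hfix)) ht
  rw [ht0, add_zero]
  exact hs

lemma two_zpow_eq_one (k : ℤ) (h : Units.mk0 (2 : ℂ) two_ne_zero ^ k = 1) : k = 0 := by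
  have h2 : (2 : ℂ) ^ k = 1 := by simpa using congrArg Units.val h
  have h3 : (2 : ℝ) ^ k = 1 := by simpa using congrArg norm h2
  exact (zpow_eq_one_iff_right₀ (by norm_num) (by norm_num)).mp h3

/-- Each Φ_λ maps the ideal (x₁x₄ − x₂x₃ − 1) into itself and hence induces a
ℂ-algebra automorphism φ_λ of R; the subalgebra of invariants of this
ℂ*-action equals the subalgebra generated by u = a₁a₂, v = b₁b₂ and
z = a₂b₁ + 1/2. -/
theorem stmt_16 :
    (∀ l : ℂˣ, ∀ p ∈ relI, Phi l p ∈ relI) ∧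
    ∃ φ : ℂˣ → (R ≃ₐ[ℂ] R),
      (∀ (l : ℂˣ) (p : P), φ l (Ideal.Quotient.mk relI p) = Ideal.Quotient.mk relI (Phi l p)) ∧
      {r : R | ∀ l : ℂˣ, φ l r = r} =
        (Algebra.adjoin ℂ {a1 * a2, b1 * b2, a2 * b1 + algebraMap ℂ R (1 / 2)} :
          Subalgebra ℂ R) := by
  refine ⟨Phi_mem_relI, phi, phi_mk, Set.ext fun r => ⟨fun hr => ?_, fun hr l => ?_⟩⟩
  · exact mem_uvz_of_phi_eq_self _ two_zpow_eq_one (hr _)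
  · exact phi_eq_self_of_mem_uvz l hr
end
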